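/- arXiv:1005.3701 — 2 statements merged into one kernel-verified Lean document; each statement's English description precedes it below -/
import Mathlib

section
/- Let X ⊆ ℕ with 0 ∈ X, gcd of all elements of X equal to 1, and upper density d̄(X) ≤ 1/2 with d̄(X) > 0. Then d̄(X + X) ≥ (3/2) d̄(X). -/
open scoped Classical

/-- Upper density of a set of natural numbers. -/
noncomputable def upperDensity (A : Set ℕ) : ℝ :=
  Filter.atTop.limsup fun n => (((Finset.Icc 1 n).filter fun m => m ∈ A).card : ℝ) / n

section Kneser

open scoped Pointwise

variable {G : Type*} [AddCommGroup G]

/-- The subgroup of all translations preserving a set. -/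
def translationStabilizer (C : Finset G) : AddSubgroup G where
  carrier := {g | ∀ x, x + g ∈ C ↔ x ∈ C}
  zero_mem' := by simp
  add_mem' := by
    intro a b ha hb x
    rw [← add_assoc, hb, ha]
  neg_mem' := by
    intro a ha x
    rw [← ha (x + -a), neg_add_cancel_right]

lemma mem_translationStabilizer_of_forall {C : Finset G} {g : G} (h : ∀ x ∈ C, x + g ∈ C) :
    g ∈ translationStabilizer C := by
  have himg : C.image (· + g) = C := by
    apply Finset.eq_of_subset_of_card_le
    · intro y hy
      obtain ⟨x, hx, rfl⟩ := Finset.mem_image.1 hy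
      exact h x hx
    · rw [Finset.card_image_of_injective _ (add_left_injective g)]
  intro x
  refine ⟨fun hx => ?_, h x⟩
  rw [← himg] at hx
  obtain ⟨y, hy, hyx⟩ := Finset.mem_image.1 hx
  rwa [← add_right_cancel hyx]

variable [Fintype G]

/-- The elements of a subgroup, as a finset. -/
noncomputable def subgroupElems (H : AddSubgroup G) : Finset G :=
  Finset.univ.filter (· ∈ H)

@[simp] lemma mem_subgroupElems {H : AddSubgroup G} {g : G} : g ∈ subgroupElems H ↔ g ∈ H := by
  simp [subgroupElems]

lemma card_le_of_stable {K : AddSubgroup G} {P : Finset G} (hP : ∀ k ∈ K, ∀ p ∈ P, p + k ∈ P)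
    (hne : P.Nonempty) : (subgroupElems K).card ≤ P.card := by
  obtain ⟨p, hp⟩ := hne
  apply Finset.card_le_card_of_injOn (p + ·)
  · intro k hk
    exact hP k (mem_subgroupElems.1 hk) p hp
  · exact (add_right_injective p).injOn

variable [DecidableEq G]

lemma card_mul_card_le_card_add_mul {H₁ H₂ : AddSubgroup G} {P Q : Finset G}
    (hP : ∀ p ∈ P, p ∈ H₁) (hQ : ∀ q ∈ Q, q ∈ H₂) :
    P.card * Q.card ≤ (subgroupElems (H₁ ⊓ H₂)).card *
      ((P ×ˢ Q).image fun z => z.1 + z.2).card := by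
  rw [← Finset.card_product]
  apply Finset.card_le_mul_card_image
  intro a ha
  obtain ⟨⟨p₀, q₀⟩, hz, rfl⟩ := Finset.mem_image.1 ha
  obtain ⟨hp₀, hq₀⟩ := Finset.mem_product.1 hz
  apply Finset.card_le_card_of_injOn (fun z => z.1 - p₀)
  · rintro ⟨p, q⟩ hpq
    simp only [Finset.coe_filter, Finset.mem_product, Set.mem_ofPred_eq] at hpq
    have hsub : p - p₀ = q₀ - q := by
      rw [sub_eq_sub_iff_add_eq_add, hpq.2, add_comm]
    simp only [Finset.mem_coe, mem_subgroupElems, AddSubgroup.mem_inf]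
    exact ⟨H₁.sub_mem (hP _ hpq.1.1) (hP _ hp₀),
      hsub ▸ H₂.sub_mem (hQ _ hq₀) (hQ _ hpq.1.2)⟩
  · rintro ⟨p, q⟩ hpq ⟨p', q'⟩ hpq' heq
    simp only [Finset.coe_filter, Set.mem_ofPred_eq] at hpq hpq'
    have hpp : p = p' := sub_left_injective heq
    subst hpp
    have := hpq.2.trans hpq'.2.symm
    simpa using this

lemma grid_arith {p p' q q' h X Y : ℕ} (hp : h ≤ p) (hq : h ≤ q) (hh : 0 < h)
    (hq' : q' = 0 ∨ h ≤ q') (hX : p * q ≤ h * X) (hY : p' * q' ≤ h * Y) :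
    p + p' ≤ X + h ∨ q + q' ≤ Y + h ∨ q + q' ≤ X := by
  by_contra! hcon
  obtain ⟨h1, h2, h3⟩ := hcon
  rcases hq' with rfl | hq'
  · have : h * X < h * q := Nat.mul_lt_mul_of_pos_left (by omega) hh
    have := Nat.mul_le_mul_right q hp
    omega
  · zify at *
    have hqp : (q : ℤ) < p' := by
      have e1 : (h : ℤ) * (X + h) < h * (p + p') := by gcongr
      have e2 : (0 : ℤ) ≤ (p - h) * (q - h) := mul_nonneg (by linarith) (by linarith)
      have e3 : (h : ℤ) * q < h * p' := by nlinarith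
      exact lt_of_mul_lt_mul_left e3 (by positivity)
    have e1 : (h : ℤ) * (Y + h) < h * (q + q') := by gcongr
    have e2 : (0 : ℤ) ≤ (p' - h) * (q' - h) := mul_nonneg (by linarith) (by linarith)
    have e3 : (h : ℤ) * p' < h * q := by nlinarith
    have := lt_of_mul_lt_mul_left e3 (by positivity)
    linarith

lemma card_sdiff_of_mem_sdiff {H₁ H₂ : AddSubgroup G} {C₁ C₂ : Finset G}
    (h₁ : ∀ h ∈ H₁, ∀ x ∈ C₁, x + h ∈ C₁) (h₂ : ∀ h ∈ H₂, ∀ x ∈ C₂, x + h ∈ C₂)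
    {x : G} (hx₂ : x ∈ C₂) (hx₁ : x ∉ C₁) :
    (subgroupElems H₁).card ≤ (C₂ \ C₁).card + (subgroupElems (H₁ ⊓ H₂)).card ∨
    (subgroupElems H₂).card ≤ (C₁ \ C₂).card + (subgroupElems (H₁ ⊓ H₂)).card ∨
    (subgroupElems H₂).card ≤ (C₂ \ C₁).card := by
  have i₁ : ∀ h ∈ H₁, ∀ y, y + h ∈ C₁ ↔ y ∈ C₁ := fun h hh y =>
    ⟨fun hy => by simpa using h₁ (-h) (H₁.neg_mem hh) _ hy, h₁ h hh y⟩
  have i₂ : ∀ h ∈ H₂, ∀ y, y + h ∈ C₂ ↔ y ∈ C₂ := fun h hh y =>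
    ⟨fun hy => by simpa using h₂ (-h) (H₂.neg_mem hh) _ hy, h₂ h hh y⟩
  set P := (subgroupElems H₁).filter (fun g => x + g ∈ C₂)
  set P' := (subgroupElems H₁).filter (fun g => x + g ∉ C₂)
  set Q := (subgroupElems H₂).filter (fun g => x + g ∉ C₁)
  set Q' := (subgroupElems H₂).filter (fun g => ¬ x + g ∉ C₁)
  have cP : P.card + P'.card = (subgroupElems H₁).card :=
    Finset.card_filter_add_card_filter_not _
  have cQ : Q.card + Q'.card = (subgroupElems H₂).card :=
    Finset.card_filter_add_card_filter_not _
  have bound : ∀ (U V : Finset G), (∀ u ∈ U, u ∈ H₁) → (∀ v ∈ V, v ∈ H₂) →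
      ∀ D : Finset G, (∀ u ∈ U, ∀ v ∈ V, x + (u + v) ∈ D) →
      U.card * V.card ≤ (subgroupElems (H₁ ⊓ H₂)).card * D.card := by
    intro U V hU hV D hD
    refine (card_mul_card_le_card_add_mul hU hV).trans (Nat.mul_le_mul_left _ ?_)
    apply Finset.card_le_card_of_injOn (x + ·)
    · intro y hy
      obtain ⟨⟨u, v⟩, huv, rfl⟩ := Finset.mem_image.1 hy
      obtain ⟨hu, hv⟩ := Finset.mem_product.1 huv
      exact hD u hu v hv
    · exact (add_right_injective x).injOn
  rw [← cP, ← cQ]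
  apply grid_arith
  · refine card_le_of_stable ?_ ⟨0, by simp [P, hx₂, H₁.zero_mem]⟩
    intro k hk p hp
    simp only [P, Finset.mem_filter, mem_subgroupElems] at hp ⊢
    exact ⟨H₁.add_mem hp.1 hk.1, by rw [← add_assoc, i₂ k hk.2]; exact hp.2⟩
  · refine card_le_of_stable ?_ ⟨0, by simp [Q, hx₁, H₂.zero_mem]⟩
    intro k hk p hp
    simp only [Q, Finset.mem_filter, mem_subgroupElems] at hp ⊢
    exact ⟨H₂.add_mem hp.1 hk.2, by rw [← add_assoc, i₁ k hk.1]; exact hp.2⟩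
  · exact Finset.card_pos.2 ⟨0, by simp [(H₁ ⊓ H₂).zero_mem]⟩
  · rcases Q'.eq_empty_or_nonempty with h | h
    · left; simp [h]
    · right
      refine card_le_of_stable ?_ h
      intro k hk p hp
      simp only [Q', Finset.mem_filter, mem_subgroupElems] at hp ⊢
      exact ⟨H₂.add_mem hp.1 hk.2, by rw [← add_assoc, i₁ k hk.1]; exact hp.2⟩
  · apply bound P Q (by simp +contextual [P]) (by simp +contextual [Q])
    intro u hu v hv
    simp only [P, Q, Finset.mem_filter, mem_subgroupElems] at hu hv
    rw [Finset.mem_sdiff]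
    constructor
    · rw [← add_assoc, i₂ v hv.1]; exact hu.2
    · rw [add_comm u, ← add_assoc, i₁ u hu.1]; exact hv.2
  · apply bound P' Q' (by simp +contextual [P']) (by simp +contextual [Q'])
    intro u hu v hv
    simp only [P', Q', Finset.mem_filter, mem_subgroupElems, not_not] at hu hv
    rw [Finset.mem_sdiff]
    constructor
    · rw [add_comm u, ← add_assoc, i₁ u hu.1]; exact hv.2
    · rw [← add_assoc, i₂ v hv.1]; exact hu.2

lemma exists_stable_union {H₁ H₂ : AddSubgroup G} {C₁ C₂ : Finset G} {N : ℕ}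
    (h₁ : ∀ h ∈ H₁, ∀ x ∈ C₁, x + h ∈ C₁) (h₂ : ∀ h ∈ H₂, ∀ x ∈ C₂, x + h ∈ C₂)
    (hN₁ : N ≤ C₁.card + (subgroupElems H₁).card) (hN₂ : N ≤ C₂.card + (subgroupElems H₂).card) :
    ∃ H : AddSubgroup G, (∀ h ∈ H, ∀ x ∈ C₁ ∪ C₂, x + h ∈ C₁ ∪ C₂) ∧
      N ≤ (C₁ ∪ C₂).card + (subgroupElems H).card := by
  by_cases s₁ : C₁ ⊆ C₂
  · rw [Finset.union_eq_right.2 s₁]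
    exact ⟨H₂, h₂, hN₂⟩
  by_cases s₂ : C₂ ⊆ C₁
  · rw [Finset.union_eq_left.2 s₂]
    exact ⟨H₁, h₁, hN₁⟩
  refine ⟨H₁ ⊓ H₂, ?_, ?_⟩
  · intro h hh x hx
    rw [Finset.mem_union] at hx ⊢
    exact hx.imp (h₁ h hh.1 x) (h₂ h hh.2 x)
  · obtain ⟨x, hx₁, hx₂⟩ := Finset.not_subset.1 s₁
    obtain ⟨y, hy₂, hy₁⟩ := Finset.not_subset.1 s₂
    have e₁ := card_sdiff_of_mem_sdiff h₁ h₂ hy₂ hy₁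
    have e₂ := card_sdiff_of_mem_sdiff h₂ h₁ hx₁ hx₂
    rw [inf_comm H₂ H₁] at e₂
    have u₁ : (C₁ ∪ C₂).card = C₁.card + (C₂ \ C₁).card := by
      rw [← Finset.union_sdiff_self_eq_union, Finset.card_union_of_disjoint Finset.disjoint_sdiff]
    have u₂ : (C₁ ∪ C₂).card = C₂.card + (C₁ \ C₂).card := by
      rw [Finset.union_comm, ← Finset.union_sdiff_self_eq_union,
        Finset.card_union_of_disjoint Finset.disjoint_sdiff]
    omega

lemma exists_stable_subset_add (A B : Finset G) {a b : G} (ha : a ∈ A) (hb : b ∈ B) :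
    ∃ (C : Finset G) (H : AddSubgroup G), C ⊆ A + B ∧ a + b ∈ C ∧
      (∀ h ∈ H, ∀ x ∈ C, x + h ∈ C) ∧ A.card + B.card ≤ C.card + (subgroupElems H).card := by
  induction hn : B.card using Nat.strong_induction_on generalizing A B with
  | _ n ih =>
  subst hn
  by_cases hstab : ∀ y ∈ B, ∀ e ∈ A, e + (y - b) ∈ A
  · refine ⟨A.image (· + b), translationStabilizer A, ?_, ?_, ?_, ?_⟩
    · intro z hz
      obtain ⟨x, hx, rfl⟩ := Finset.mem_image.1 hz
      exact Finset.add_mem_add hx hb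
    · exact Finset.mem_image_of_mem _ ha
    · intro h hh z hz
      obtain ⟨x, hx, rfl⟩ := Finset.mem_image.1 hz
      exact Finset.mem_image.2 ⟨x + h, (hh x).2 hx, add_right_comm _ _ _⟩
    · rw [Finset.card_image_of_injective _ (add_left_injective b)]
      refine Nat.add_le_add_left ?_ _
      apply Finset.card_le_card_of_injOn (· - b)
      · intro y hy
        exact mem_subgroupElems.2 (mem_translationStabilizer_of_forall (hstab y hy))
      · exact sub_left_injective.injOn
  · push Not at hstab
    obtain ⟨y, hy, e, he, hye⟩ := hstab
    set T := Finset.addDysonETransform (e - b) (A, B)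
    have hcard : T.1.card + T.2.card = A.card + B.card :=
      Finset.addDysonETransform.card (e - b) (A, B)
    have hsub : T.1 + T.2 ⊆ A + B := Finset.addDysonETransform.subset (e - b) (A, B)
    have haT : a ∈ T.1 := Finset.mem_union_left _ ha
    have hbT : b ∈ T.2 := by
      refine Finset.mem_inter.2 ⟨hb, Finset.mem_vadd_finset.2 ⟨e, he, ?_⟩⟩
      simp [vadd_eq_add]
    have hlt : T.2.card < B.card := by
      apply Finset.card_lt_card
      refine ⟨Finset.inter_subset_left, fun hBT => hye ?_⟩
      obtain ⟨z, hz, hzy⟩ := Finset.mem_vadd_finset.1 (Finset.mem_inter.1 (hBT hy)).2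
      have : e + (y - b) = z := by
        rw [← hzy, vadd_eq_add]; abel
      rwa [this]
    obtain ⟨C, H, hC, hab, hst, hle⟩ := ih _ hlt T.1 T.2 haT hbT rfl
    exact ⟨C, H, hC.trans hsub, hab, hst, hcard ▸ hle⟩

lemma exists_stabilizer_card_add_card_le (A B : Finset G) (hA : A.Nonempty) (hB : B.Nonempty) :
    ∃ H : AddSubgroup G, (∀ h ∈ H, ∀ x ∈ A + B, x + h ∈ A + B) ∧
      A.card + B.card ≤ (A + B).card + (subgroupElems H).card := by
  have key : ∀ S : Finset G, S.Nonempty → S ⊆ A + B → ∃ (C : Finset G) (H : AddSubgroup G),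
      S ⊆ C ∧ C ⊆ A + B ∧ (∀ h ∈ H, ∀ x ∈ C, x + h ∈ C) ∧
      A.card + B.card ≤ C.card + (subgroupElems H).card := by
    have single : ∀ x ∈ A + B, ∃ (C : Finset G) (H : AddSubgroup G),
        {x} ⊆ C ∧ C ⊆ A + B ∧ (∀ h ∈ H, ∀ x ∈ C, x + h ∈ C) ∧
        A.card + B.card ≤ C.card + (subgroupElems H).card := by
      intro x hx
      obtain ⟨a, ha, b, hb, rfl⟩ := Finset.mem_add.1 hx
      obtain ⟨C, H, h1, h2, h3, h4⟩ := exists_stable_subset_add A B ha hb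
      exact ⟨C, H, by simpa using h2, h1, h3, h4⟩
    intro S hS
    induction hS using Finset.Nonempty.cons_induction with
    | singleton x => intro h; exact single x (by simpa using h)
    | cons x S hxS hS ih =>
      intro h
      rw [Finset.cons_eq_insert, Finset.insert_subset_iff] at h
      obtain ⟨C₁, H₁, a1, a2, a3, a4⟩ := single x h.1
      obtain ⟨C₂, H₂, b1, b2, b3, b4⟩ := ih h.2
      obtain ⟨H, c1, c2⟩ := exists_stable_union a3 b3 a4 b4
      refine ⟨C₁ ∪ C₂, H, ?_, Finset.union_subset a2 b2, c1, c2⟩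
      rw [Finset.cons_eq_insert, Finset.insert_eq]
      exact Finset.union_subset_union a1 b1
  obtain ⟨C, H, h1, h2, h3, h4⟩ := key (A + B) (hA.add hB) subset_rfl
  obtain rfl := h2.antisymm h1
  exact ⟨H, h3, h4⟩

/-- **Kneser's theorem** for the sum of a set with itself. -/
theorem kneser_add_self (A : Finset G) (hA : A.Nonempty) :
    2 * (A + subgroupElems (translationStabilizer (A + A))).card ≤
      (A + A).card + (subgroupElems (translationStabilizer (A + A))).card := by
  set K := translationStabilizer (A + A)
  have hsum : (A + subgroupElems K) + (A + subgroupElems K) = A + A := by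
    ext z
    constructor
    · intro hz
      obtain ⟨u, hu, v, hv, rfl⟩ := Finset.mem_add.1 hz
      obtain ⟨a, ha, k, hk, rfl⟩ := Finset.mem_add.1 hu
      obtain ⟨b, hb, l, hl, rfl⟩ := Finset.mem_add.1 hv
      rw [add_add_add_comm]
      exact (K.add_mem (mem_subgroupElems.1 hk) (mem_subgroupElems.1 hl) _).2
        (Finset.add_mem_add ha hb)
    · have hA' : A ⊆ A + subgroupElems K := fun a ha =>
        Finset.mem_add.2 ⟨a, ha, 0, mem_subgroupElems.2 K.zero_mem, add_zero a⟩
      exact fun hz => Finset.add_subset_add hA' hA' hz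
  have hne : (A + subgroupElems K).Nonempty :=
    hA.add ⟨0, mem_subgroupElems.2 K.zero_mem⟩
  obtain ⟨H, h1, h2⟩ := exists_stabilizer_card_add_card_le _ _ hne hne
  rw [hsum] at h1 h2
  have hHK : (subgroupElems H).card ≤ (subgroupElems K).card := by
    apply Finset.card_le_card
    intro h hh
    exact mem_subgroupElems.2
      (mem_translationStabilizer_of_forall (h1 h (mem_subgroupElems.1 hh)))
  omega

end Kneser

section Freiman

open scoped Pointwise

variable {m : ℕ} [NeZero m] {A : Finset ℕ}

lemma card_image_cast_add_one (h0 : 0 ∈ A) (hm : m ∈ A) (hA : ∀ a ∈ A, a ≤ m) :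
    (A.image (Nat.cast : ℕ → ZMod m)).card + 1 = A.card := by
  have himg : A.image (Nat.cast : ℕ → ZMod m) = (A.erase m).image Nat.cast := by
    apply Finset.Subset.antisymm _ (Finset.image_subset_image (Finset.erase_subset _ _))
    intro z hz
    obtain ⟨a, ha, rfl⟩ := Finset.mem_image.1 hz
    by_cases ham : a = m
    · subst ham
      exact Finset.mem_image.2 ⟨0, Finset.mem_erase.2 ⟨(NeZero.ne a).symm, h0⟩, by simp⟩
    · exact Finset.mem_image_of_mem _ (Finset.mem_erase.2 ⟨ham, ha⟩)
  rw [himg, Finset.card_image_of_injOn, Finset.card_erase_add_one hm]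
  intro a ha b hb hab
  have hlt : ∀ c ∈ A.erase m, c < m := fun c hc =>
    lt_of_le_of_ne (hA c (Finset.mem_of_mem_erase hc)) (Finset.ne_of_mem_erase hc)
  have h := (ZMod.natCast_eq_natCast_iff' a b m).1 hab
  rwa [Nat.mod_eq_of_lt (hlt a ha), Nat.mod_eq_of_lt (hlt b hb)] at h

lemma card_add_card_le_card_filter_cast_mem (h0 : 0 ∈ A) (hm : m ∈ A) (hA : ∀ a ∈ A, a ≤ m)
    {T : Finset (ZMod m)} (hAT : A.image Nat.cast ⊆ T)
    (hT : T ⊆ A.image Nat.cast + A.image Nat.cast) :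
    T.card + A.card ≤ ((A + A).filter fun n : ℕ => (n : ZMod m) ∈ T).card := by
  set E := (A + A).filter fun n : ℕ => (n : ZMod m) ∈ T
  have hsub : A.image (· + m) ⊆ E := by
    intro z hz
    obtain ⟨a, ha, rfl⟩ := Finset.mem_image.1 hz
    exact Finset.mem_filter.2 ⟨Finset.add_mem_add ha hm,
      hAT (Finset.mem_image.2 ⟨a, ha, by simp⟩)⟩
  have hcard : (A.image (· + m)).card = A.card :=
    Finset.card_image_of_injective _ (add_left_injective m)
  rw [← Finset.card_sdiff_add_card_eq_card hsub, hcard]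
  refine Nat.add_le_add_right ?_ _
  have hsurj : T ⊆ (E \ A.image (· + m)).image Nat.cast := by
    intro t ht
    by_cases htA : t ∈ A.image (Nat.cast : ℕ → ZMod m)
    · have : ∃ a ∈ A, a < m ∧ (a : ZMod m) = t := by
        obtain ⟨a, ha, rfl⟩ := Finset.mem_image.1 htA
        rcases (hA a ha).lt_or_eq with h | rfl
        · exact ⟨a, ha, h, rfl⟩
        · exact ⟨0, h0, Nat.pos_of_neZero a, by simp⟩
      obtain ⟨a, ha, ham, rfl⟩ := this
      refine Finset.mem_image.2 ⟨a, Finset.mem_sdiff.2 ⟨Finset.mem_filter.2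
        ⟨Finset.mem_add.2 ⟨a, ha, 0, h0, add_zero a⟩, ht⟩, fun hmem => ?_⟩, rfl⟩
      obtain ⟨b, -, hb⟩ := Finset.mem_image.1 hmem
      omega
    · obtain ⟨x, hx, y, hy, rfl⟩ := Finset.mem_add.1 (hT ht)
      obtain ⟨a, ha, rfl⟩ := Finset.mem_image.1 hx
      obtain ⟨b, hb, rfl⟩ := Finset.mem_image.1 hy
      refine Finset.mem_image.2 ⟨a + b, Finset.mem_sdiff.2 ⟨Finset.mem_filter.2
        ⟨Finset.add_mem_add ha hb, by simpa using ht⟩, fun hmem => htA ?_⟩, by simp⟩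
      obtain ⟨c, hc, hcab⟩ := Finset.mem_image.1 hmem
      refine Finset.mem_image.2 ⟨c, hc, ?_⟩
      rw [← Nat.cast_add, ← hcab]
      simp
  exact (Finset.card_le_card hsurj).trans Finset.card_image_le


lemma eq_top_of_forall_cast_mem (hgcd : ∀ d : ℕ, (∀ a ∈ A, d ∣ a) → d = 1)
    {K : AddSubgroup (ZMod m)} (hK : ∀ a ∈ A, (a : ZMod m) ∈ K) : K = ⊤ := by
  obtain ⟨g, hg⟩ := Int.subgroup_cyclic (K.comap (Int.castAddHom (ZMod m)))
  have hmem : ∀ z : ℤ, (z : ZMod m) ∈ K ↔ g ∣ z := by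
    intro z
    rw [← Int.mem_zmultiples_iff, AddSubgroup.zmultiples_eq_closure, ← hg]
    rfl
  have h1 : g.natAbs = 1 := by
    apply hgcd
    intro a ha
    have := (hmem a).1 (by simpa using hK a ha)
    exact Int.natAbs_dvd_natAbs.2 this
  refine (AddSubgroup.eq_top_iff' K).2 fun x => ?_
  have := (hmem (x.val : ℤ)).2 (Int.isUnit_iff_natAbs_eq.2 h1).dvd
  simpa using this

/-- **Freiman theorem** on sets of small doubling, in the form of a lower bound for the size of the sumset. -/
theorem freiman_three_mul_card (h0 : 0 ∈ A) (hm : m ∈ A) (hA : ∀ a ∈ A, a ≤ m)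
    (hgcd : ∀ d : ℕ, (∀ a ∈ A, d ∣ a) → d = 1) :
    3 * A.card ≤ (A + A).card + 3 ∨ A.card + m ≤ (A + A).card := by
  set B : Finset (ZMod m) := A.image Nat.cast
  set K := translationStabilizer (B + B)
  set H := subgroupElems K with hH
  have hBcard : B.card + 1 = A.card := card_image_cast_add_one h0 hm hA
  have hB0 : (0 : ZMod m) ∈ B := Finset.mem_image.2 ⟨0, h0, by simp⟩
  have hBT : B ⊆ B + B := fun x hx => Finset.mem_add.2 ⟨x, hx, 0, hB0, add_zero x⟩
  have hBS : B ⊆ B + H := fun x hx =>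
    Finset.mem_add.2 ⟨x, hx, 0, mem_subgroupElems.2 K.zero_mem, add_zero x⟩
  have hkn : 2 * (B + H).card ≤ (B + B).card + H.card := kneser_add_self B ⟨0, hB0⟩
  by_cases hTS : B + B ⊆ B + H
  · right
    have hHS : H ⊆ B + H := fun x hx => Finset.mem_add.2 ⟨0, hB0, x, hx, zero_add x⟩
    have hcard := Finset.card_le_card hTS
    have hSH : H = B + H := Finset.eq_of_subset_of_card_le hHS (by omega)
    have hK : K = ⊤ := eq_top_of_forall_cast_mem hgcd fun a ha => by
      have : (a : ZMod m) ∈ B + H := hBS (Finset.mem_image_of_mem _ ha)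
      rw [← hSH] at this
      exact mem_subgroupElems.1 this
    have huniv : B + B = Finset.univ := by
      refine Finset.eq_univ_of_forall fun x => ?_
      have hx : x ∈ K := hK ▸ AddSubgroup.mem_top x
      have := (hx 0).2 (hBT hB0)
      rwa [zero_add] at this
    have := card_add_card_le_card_filter_cast_mem h0 hm hA hBT subset_rfl
    have hle := this.trans (Finset.card_filter_le _ _)
    rw [huniv, Finset.card_univ, ZMod.card] at hle
    omega
  · left
    obtain ⟨t, htT, htS⟩ := Finset.not_subset.1 hTS
    obtain ⟨x, hx, y, hy, rfl⟩ := Finset.mem_add.1 htT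
    set T' := (B + B).filter fun z => z - (x + y) ∉ K 
    have hBT' : B ⊆ T' := fun z hz => Finset.mem_filter.2 ⟨hBT hz, fun hzK => htS
      (Finset.mem_add.2 ⟨z, hz, -(z - (x + y)), mem_subgroupElems.2 (K.neg_mem hzK), by abel⟩)⟩
    have hcount := card_add_card_le_card_filter_cast_mem h0 hm hA hBT' (Finset.filter_subset _ _)
    have hTT' : (B + B).card ≤ T'.card + H.card := by
      rw [← Finset.card_filter_add_card_filter_not (s := B + B) (fun z => z - (x + y) ∉ K)]
      refine Nat.add_le_add_left (Finset.card_le_card_of_injOn (· - (x + y)) ?_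
        sub_left_injective.injOn) _
      intro z hz
      simpa [hH] using (Finset.mem_filter.1 hz).2
    have side : ∀ x ∈ B, H.card + B.card ≤
        (A.filter fun a : ℕ => (a : ZMod m) - x ∈ K).card + (B + H).card := by
      intro x hx
      rw [← Finset.card_sdiff_add_card_eq_card hBS, ← add_assoc]
      refine Nat.add_le_add_right ?_ _
      have himg : H.image (x + ·) ⊆
          (A.filter fun a : ℕ => (a : ZMod m) - x ∈ K).image Nat.cast ∪ ((B + H) \ B) := by
        intro z hz
        obtain ⟨h, hh, rfl⟩ := Finset.mem_image.1 hz
        rw [Finset.mem_union]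
        by_cases hzB : x + h ∈ B
        · left
          obtain ⟨a, ha, hax⟩ := Finset.mem_image.1 hzB
          refine Finset.mem_image.2 ⟨a, Finset.mem_filter.2 ⟨ha, ?_⟩, hax⟩
          rw [hax, add_sub_cancel_left]
          exact mem_subgroupElems.1 hh
        · right
          exact Finset.mem_sdiff.2 ⟨Finset.add_mem_add hx hh, hzB⟩
      have hle := (Finset.card_le_card himg).trans (Finset.card_union_le _ _)
      rw [Finset.card_image_of_injective _ (add_right_injective x)] at hle
      exact hle.trans (Nat.add_le_add_right Finset.card_image_le _)
    have nonempty : ∀ x ∈ B, (A.filter fun a : ℕ => (a : ZMod m) - x ∈ K).Nonempty := by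
      intro x hx
      obtain ⟨a, ha, rfl⟩ := Finset.mem_image.1 hx
      exact ⟨a, Finset.mem_filter.2 ⟨ha, by simp [K.zero_mem]⟩⟩
    have hcd := cauchy_davenport_add_of_linearOrder_isCancelAdd (nonempty x hx) (nonempty y hy)
    have hsub : (A.filter fun a : ℕ => (a : ZMod m) - x ∈ K) +
        (A.filter fun a : ℕ => (a : ZMod m) - y ∈ K) ⊆
        (A + A).filter fun n : ℕ => ¬ (n : ZMod m) ∈ T' := by
      intro n hn
      obtain ⟨a, ha, b, hb, rfl⟩ := Finset.mem_add.1 hn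
      rw [Finset.mem_filter] at ha hb
      refine Finset.mem_filter.2 ⟨Finset.add_mem_add ha.1 hb.1, fun hmem => ?_⟩
      apply (Finset.mem_filter.1 hmem).2
      rw [Nat.cast_add, add_sub_add_comm]
      exact K.add_mem ha.2 hb.2
    have hcard := Finset.card_le_card hsub
    have htotal := Finset.card_filter_add_card_filter_not (s := A + A)
      (fun n : ℕ => (n : ZMod m) ∈ T')
    have sx := side x hx
    have sy := side y hy
    omega

end Freiman

section UpperDensity

open scoped Pointwise

lemma exists_bound_forall_dvd {X : Set ℕ} (hgcd : ∀ d : ℕ, (∀ x ∈ X, d ∣ x) → d = 1) :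
    ∃ N, ∀ d : ℕ, (∀ x ∈ X, x ≤ N → d ∣ x) → d = 1 := by
  have hne : ∀ d : ℕ, ∃ x, d ≠ 1 → x ∈ X ∧ ¬ d ∣ x := by
    intro d
    by_cases hd : d = 1
    · exact ⟨0, fun h => absurd hd h⟩
    · by_contra! hcon
      exact hd (hgcd d fun x hx => by_contra fun hdx => hdx ((hcon x).2 hx))
  choose f hf using hne
  have h0 := hf 0 (by norm_num)
  have hpos : 0 < f 0 := Nat.pos_of_ne_zero fun h => h0.2 (by simp [h])
  refine ⟨(Finset.range (f 0 + 1)).sup f, fun d hd => by_contra fun hd1 => ?_⟩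
  have hle : ∀ e ≤ f 0, f e ≤ (Finset.range (f 0 + 1)).sup f := fun e he =>
    Finset.le_sup (Finset.mem_range.2 (by omega))
  have hdle := Nat.le_of_dvd hpos (hd _ h0.1 (hle 0 (Nat.zero_le _)))
  exact (hf d hd1).2 (hd _ (hf d hd1).1 (hle d hdle))

lemma exists_card_sumset_bound {X : Set ℕ} (h0 : 0 ∈ X) {N n : ℕ}
    (hN : ∀ d : ℕ, (∀ x ∈ X, x ≤ N → d ∣ x) → d = 1) (hn : N ≤ n)
    (hpos : 0 < ((Finset.Icc 1 n).filter fun m => m ∈ X).card) :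
    ∃ m ≤ n, ((Finset.Icc 1 n).filter fun m => m ∈ X).card ≤ m ∧
      (3 * ((Finset.Icc 1 n).filter fun m => m ∈ X).card ≤ ((Finset.Icc 1 (2 * m)).filter
          fun m => m ∈ {n : ℕ | ∃ x ∈ X, ∃ y ∈ X, n = x + y}).card + 1 ∨
        ((Finset.Icc 1 n).filter fun m => m ∈ X).card + m ≤ ((Finset.Icc 1 (2 * m)).filter
          fun m => m ∈ {n : ℕ | ∃ x ∈ X, ∃ y ∈ X, n = x + y}).card) := by
  set F := (Finset.Icc 1 n).filter fun m => m ∈ X with hF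
  have hFmem : ∀ a, a ∈ F ↔ (1 ≤ a ∧ a ≤ n) ∧ a ∈ X := by simp [hF]
  have hFne := Finset.card_pos.1 hpos
  set m := F.max' hFne
  have hm : m ∈ F := F.max'_mem hFne
  have hmax : ∀ a ∈ F, a ≤ m := fun a ha => F.le_max' a ha
  have hm' := (hFmem m).1 hm
  refine ⟨m, hm'.1.2, ?_, ?_⟩
  · have hsub : F ⊆ Finset.Icc 1 m := fun a ha =>
      Finset.mem_Icc.2 ⟨((hFmem a).1 ha).1.1, hmax a ha⟩
    simpa using Finset.card_le_card hsub
  · have : NeZero m := ⟨by omega⟩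
    set A := insert 0 F
    have hAcard : A.card = F.card + 1 := Finset.card_insert_of_notMem fun h => by
      simpa using ((hFmem 0).1 h).1.1
    have hAmax : ∀ a ∈ A, a ≤ m := by
      intro a ha
      rcases Finset.mem_insert.1 ha with rfl | ha
      · exact Nat.zero_le _
      · exact hmax a ha
    have hAX : ∀ a ∈ A, a ∈ X := by
      intro a ha
      rcases Finset.mem_insert.1 ha with rfl | ha
      · exact h0
      · exact ((hFmem a).1 ha).2
    have hfr := freiman_three_mul_card (A := A) (m := m) (Finset.mem_insert_self _ _)
      (Finset.mem_insert_of_mem hm) hAmax fun d hd => hN d fun x hx hxN => by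
        rcases Nat.eq_zero_or_pos x with rfl | hx0
        · exact dvd_zero d
        · exact hd x (Finset.mem_insert_of_mem ((hFmem x).2 ⟨⟨hx0, hxN.trans hn⟩, hx⟩))
    have hsub : (A + A).erase 0 ⊆ (Finset.Icc 1 (2 * m)).filter
        fun m => m ∈ {n : ℕ | ∃ x ∈ X, ∃ y ∈ X, n = x + y} := by
      intro z hz
      obtain ⟨hz0, hz⟩ := Finset.mem_erase.1 hz
      obtain ⟨a, ha, b, hb, rfl⟩ := Finset.mem_add.1 hz
      have := hAmax a ha
      have := hAmax b hb
      exact Finset.mem_filter.2 ⟨Finset.mem_Icc.2 ⟨by omega, by omega⟩,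
        a, hAX a ha, b, hAX b hb, rfl⟩
    have hle := Finset.card_le_card hsub
    have := Finset.pred_card_le_card_erase (s := A + A) (a := 0)
    omega

lemma card_filter_Icc_div_le_one (A : Set ℕ) (n : ℕ) :
    (((Finset.Icc 1 n).filter fun m => m ∈ A).card : ℝ) / n ≤ 1 := by
  apply div_le_one_of_le₀ _ (Nat.cast_nonneg n)
  have := Finset.card_filter_le (Finset.Icc 1 n) fun m => m ∈ A
  rw [Nat.card_Icc, Nat.add_sub_cancel] at this
  exact_mod_cast this

lemma frequently_lt_of_lt_upperDensity {A : Set ℕ} {c : ℝ} (h : c < upperDensity A) :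
    ∃ᶠ n : ℕ in Filter.atTop, c < (((Finset.Icc 1 n).filter fun m => m ∈ A).card : ℝ) / n :=
  Filter.frequently_lt_of_lt_limsup
    (Filter.isCoboundedUnder_le_of_le _ (x := 0) fun n => by positivity) h

lemma eventually_lt_of_upperDensity_lt {A : Set ℕ} {c : ℝ} (h : upperDensity A < c) :
    ∀ᶠ n : ℕ in Filter.atTop, (((Finset.Icc 1 n).filter fun m => m ∈ A).card : ℝ) / n < c :=
  Filter.eventually_lt_of_limsup_lt h
    (Filter.isBoundedUnder_of ⟨1, card_filter_Icc_div_le_one A⟩)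

end UpperDensity

theorem sumset_density_small (X : Set ℕ) (h0 : 0 ∈ X)
    (hgcd : ∀ d : ℕ, (∀ x ∈ X, d ∣ x) → d = 1)
    (hpos : 0 < upperDensity X) (hle : upperDensity X ≤ 1 / 2) :
    (3 / 2) * upperDensity X ≤ upperDensity {n : ℕ | ∃ x ∈ X, ∃ y ∈ X, n = x + y} := by
  by_contra! hcon
  obtain ⟨β, hβ₁, hβ₂⟩ := exists_between hcon
  obtain ⟨γ, hγ₁, hγ₂⟩ : ∃ γ, max (2 / 3 * β) 0 < γ ∧ γ < upperDensity X :=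
    exists_between (max_lt (by linarith) hpos)
  obtain ⟨hγβ, hγ0⟩ := max_lt_iff.1 hγ₁
  obtain ⟨N, hN⟩ := exists_bound_forall_dvd hgcd
  obtain ⟨M, hM⟩ := Filter.eventually_atTop.1 (eventually_lt_of_upperDensity_lt hβ₁)
  obtain ⟨L, hL⟩ := exists_nat_gt (1 / (3 * γ - 2 * β))
  obtain ⟨R, hR⟩ := exists_nat_gt (((M + L : ℕ) : ℝ) / γ)
  obtain ⟨n, hn, hfreq⟩ := Filter.frequently_atTop.1 (frequently_lt_of_lt_upperDensity hγ₂)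
    (N + R + 1)
  have hn0 : (0 : ℝ) < n := by exact_mod_cast (by omega : 0 < n)
  rw [lt_div_iff₀ hn0] at hfreq
  have hcpos : 0 < ((Finset.Icc 1 n).filter fun m => m ∈ X).card := by
    exact_mod_cast (mul_pos hγ0 hn0).trans hfreq
  obtain ⟨m, hmn, hcm, hor⟩ := exists_card_sumset_bound h0 hN (by omega) hcpos
  have hmn' : (m : ℝ) ≤ n := by exact_mod_cast hmn
  have hcm' : (((Finset.Icc 1 n).filter fun m => m ∈ X).card : ℝ) ≤ m := by exact_mod_cast hcm
  have hML : M + L < m := by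
    rw [div_lt_iff₀ hγ0] at hR
    have hRn : (R : ℝ) ≤ n := by exact_mod_cast (by omega : R ≤ n)
    have : ((M + L : ℕ) : ℝ) < m := by nlinarith
    exact_mod_cast this
  have hm0 : (0 : ℝ) < m := by exact_mod_cast (by omega : 0 < m)
  have hsum := hM (2 * m) (by omega)
  rw [div_lt_iff₀ (by push_cast; positivity)] at hsum
  push_cast at hsum
  have hγm : γ * m ≤ γ * n := mul_le_mul_of_nonneg_left hmn' hγ0.le
  rcases hor with h | h
  · have h' : 3 * (((Finset.Icc 1 n).filter fun m => m ∈ X).card : ℝ) ≤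
        ((Finset.Icc 1 (2 * m)).filter
          fun m => m ∈ {n : ℕ | ∃ x ∈ X, ∃ y ∈ X, n = x + y}).card + 1 := by exact_mod_cast h
    have hd : 0 < 3 * γ - 2 * β := by linarith
    rw [div_lt_iff₀ hd] at hL
    have hLm : (L : ℝ) ≤ m := by exact_mod_cast (by omega : L ≤ m)
    have := mul_le_mul_of_nonneg_right hLm hd.le
    linarith
  · have h' : (((Finset.Icc 1 n).filter fun m => m ∈ X).card : ℝ) + m ≤
        ((Finset.Icc 1 (2 * m)).filter
          fun m => m ∈ {n : ℕ | ∃ x ∈ X, ∃ y ∈ X, n = x + y}).card := by exact_mod_cast h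
    have : (γ + 1 - 2 * β) * m < 0 := by linarith
    have : 0 < (γ + 1 - 2 * β) * m := mul_pos (by linarith) hm0
    linarith
end

section
/- Let G = ℤ/gℤ, a, b coprime positive integers, and U ⊆ G with 0 ∈ U such that U is not periodic and U is not contained in any proper subgroup of G. Then |aU + bU| = |U| if and only if g = gcd(g,a)·gcd(g,b) and there exist sets V ⊆ gcd(g,b)·G and X ⊆ gcd(g,a)·G with U = V + X and |U| = |V|·|X|. -/
/-- The set of twisted sums `(α * u.1 + v.1, u.2 + β * v.2)` with `u, v ∈ U`. -/
def twistedSum {A B : Type*} [CommRing A] [CommRing B] [DecidableEq A] [DecidableEq B]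
    (α : A) (β : B) (U : Finset (A × B)) : Finset (A × B) :=
  Finset.image₂ (fun u v => (α * u.1 + v.1, u.2 + β * v.2)) U U

lemma exists_section {A B : Type*} [Nonempty A] [DecidableEq B] (U : Finset (A × B)) :
    ∃ f : B → A, ∀ y ∈ U.image Prod.snd, (f y, y) ∈ U := by
  have h : ∀ y, ∃ x, y ∈ U.image Prod.snd → (x, y) ∈ U := by
    intro y
    by_cases hy : y ∈ U.image Prod.snd
    · obtain ⟨⟨x, y⟩, hu, rfl⟩ := Finset.mem_image.1 hy
      exact ⟨x, fun _ => hu⟩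
    · exact ⟨Classical.arbitrary A, fun h => absurd h hy⟩
  choose f hf using h
  exact ⟨f, hf⟩

section twistedSum

variable {A B : Type*} [CommRing A] [CommRing B] [DecidableEq A] [DecidableEq B]
  {α : A} {β : B} {U : Finset (A × B)}

lemma mk_mem_twistedSum {u v : A × B} (hu : u ∈ U) (hv : v ∈ U) :
    (α * u.1 + v.1, u.2 + β * v.2) ∈ twistedSum α β U :=
  Finset.mem_image₂_of_mem hu hv

/-- Part of the twisted sum set using one fibre over `y₀` and one point `f y` in each fibre. -/
lemma image_fiber_subset_twistedSum {f : B → A} (hf : ∀ y ∈ U.image Prod.snd, (f y, y) ∈ U)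
    (y₀ : B) :
    (U.image Prod.snd ×ˢ U.filter (fun u => u.2 = y₀)).image
      (fun p => (α * f p.1 + p.2.1, p.1 + β * p.2.2)) ⊆ twistedSum α β U := by
  intro s hs
  obtain ⟨⟨y, v⟩, hp, rfl⟩ := Finset.mem_image.1 hs
  obtain ⟨hy, hv⟩ := Finset.mem_product.1 hp
  exact mk_mem_twistedSum (hf y hy) (Finset.mem_filter.1 hv).1

lemma card_image_fiber (f : B → A) (y₀ : B) :
    ((U.image Prod.snd ×ˢ U.filter (fun u => u.2 = y₀)).image
      (fun p => (α * f p.1 + p.2.1, p.1 + β * p.2.2))).card =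
      (U.image Prod.snd).card * (U.filter (fun u => u.2 = y₀)).card := by
  rw [Finset.card_image_of_injOn, Finset.card_product]
  rintro ⟨y, v⟩ hp ⟨y', v'⟩ hp' h
  have hv := (Finset.mem_filter.1 (Finset.mem_product.1 hp).2).2
  have hv' := (Finset.mem_filter.1 (Finset.mem_product.1 hp').2).2
  simp only [Prod.mk.injEq] at h hv hv'
  obtain ⟨h1, h2⟩ := h
  rw [hv, hv'] at h2
  obtain rfl := add_right_cancel h2
  exact Prod.ext rfl (Prod.ext (add_left_cancel h1) (hv.trans hv'.symm))

/-- If the twisted sum set is no larger than `U`, all fibres of `U` have the same size. -/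
lemma card_eq_card_mul_card_fiber (hU : U.Nonempty)
    (hcard : (twistedSum α β U).card ≤ U.card) {y₀ : B} (hy₀ : y₀ ∈ U.image Prod.snd) :
    U.card = (U.image Prod.snd).card * (U.filter (fun u => u.2 = y₀)).card := by
  obtain ⟨f, hf⟩ := exists_section U
  obtain ⟨y₁, -, hmax⟩ := Finset.exists_max_image (U.image Prod.snd)
    (fun y => (U.filter (fun u => u.2 = y)).card) (hU.image _)
  have hle : (U.image Prod.snd).card * (U.filter (fun u => u.2 = y₁)).card ≤ U.card := by
    rw [← card_image_fiber (α := α) (β := β) f y₁]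
    exact (Finset.card_le_card (image_fiber_subset_twistedSum hf y₁)).trans hcard
  have hsum := Finset.card_eq_sum_card_image Prod.snd U
  have hge : U.card ≤ ∑ _y ∈ U.image Prod.snd, (U.filter (fun u => u.2 = y₁)).card := by
    rw [hsum]
    exact Finset.sum_le_sum hmax
  have hconst := Finset.sum_const (s := U.image Prod.snd) (U.filter (fun u => u.2 = y₁)).card
  rw [smul_eq_mul] at hconst
  have heq := (Finset.sum_eq_sum_iff_of_le hmax).1 (by omega) y₀ hy₀
  rw [heq]
  omega

lemma mem_twistedSum_iff_exists (hU : U.Nonempty)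
    (hcard : (twistedSum α β U).card ≤ U.card) {y₀ : B} (hy₀ : y₀ ∈ U.image Prod.snd)
    {f : B → A} (hf : ∀ y ∈ U.image Prod.snd, (f y, y) ∈ U) {z : A} {w : B} :
    (z, w) ∈ twistedSum α β U ↔
      ∃ y ∈ U.image Prod.snd, ∃ x, (x, y₀) ∈ U ∧ z = α * f y + x ∧ w = y + β * y₀ := by
  have h := Finset.eq_of_subset_of_card_le (image_fiber_subset_twistedSum (α := α) (β := β) hf y₀)
    (by rwa [card_image_fiber, ← card_eq_card_mul_card_fiber hU hcard hy₀])
  rw [← h, Finset.mem_image]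
  constructor
  · rintro ⟨⟨y, x, y'⟩, hp, hs⟩
    obtain ⟨hy, hv⟩ := Finset.mem_product.1 hp
    obtain ⟨hx, hy'⟩ := Finset.mem_filter.1 hv
    simp only [Prod.mk.injEq] at hx hy' hs
    subst hy'
    exact ⟨y, hy, x, hx, hs.1.symm, hs.2.symm⟩
  · rintro ⟨y, hy, x, hx, rfl, rfl⟩
    exact ⟨(y, x, y₀), Finset.mem_product.2 ⟨hy, Finset.mem_filter.2 ⟨hx, rfl⟩⟩, rfl⟩

lemma mem_iff_mem_twistedSum (hcard : (twistedSum α β U).card ≤ U.card)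
    {y₀ : B} (hy₀ : y₀ ∈ U.image Prod.snd) {u : A} {y : B} (hu : (u, y) ∈ U) (x : A) :
    (x, y₀) ∈ U ↔ (α * u + x, y + β * y₀) ∈ twistedSum α β U := by
  refine ⟨fun hx => mk_mem_twistedSum hu hx, fun hs => ?_⟩
  obtain ⟨f, hf⟩ := exists_section U
  have hf' : ∀ y' ∈ U.image Prod.snd, (Function.update f y u y', y') ∈ U := by
    intro y' hy'
    by_cases h : y' = y
    · subst h
      simpa using hu
    · simpa [h] using hf y' hy'
  obtain ⟨y', -, x', hx', h1, h2⟩ := (mem_twistedSum_iff_exists ⟨_, hu⟩ hcard hy₀ hf').1 hs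
  obtain rfl := add_right_cancel h2
  rw [Function.update_self] at h1
  rwa [add_left_cancel h1]

/-- If `α` is nilpotent, an aperiodic set whose twisted sum set is no larger than itself is a
product of subsets of the annihilators of `α` and `β`. -/
theorem exists_eq_product_of_card_twistedSum_le (hα : IsNilpotent α) (h0 : (0, 0) ∈ U)
    (hnp : ∀ h : A × B, (∀ u ∈ U, u + h ∈ U) → h = 0)
    (hcard : (twistedSum α β U).card ≤ U.card) :
    (∀ x y, (x, y) ∈ U ↔ (x, 0) ∈ U ∧ (0, y) ∈ U) ∧ ∀ u ∈ U, α * u.1 = 0 ∧ β * u.2 = 0 := by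
  have hsnd : ∀ {x y}, (x, y) ∈ U → y ∈ U.image Prod.snd :=
    fun h => Finset.mem_image_of_mem Prod.snd h
  have hzero := hsnd h0
  have hstable : ∀ y ∈ U.image Prod.snd, ∀ y' ∈ U.image Prod.snd,
      y + β * y' ∈ U.image Prod.snd := by
    intro y hy y' hy'
    obtain ⟨f, hf⟩ := exists_section U
    obtain ⟨y'', hy'', _, -, -, h⟩ := (mem_twistedSum_iff_exists ⟨_, h0⟩ hcard hzero hf).1
      (mk_mem_twistedSum (α := α) (β := β) (hf y hy) (hf y' hy'))
    simpa [h] using hy''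
  have hconst : ∀ u u' y, (u, y) ∈ U → (u', y) ∈ U → α * u = α * u' := by
    intro u u' y hu hu'
    have h := hnp (α * u - α * u', 0) (by
      rintro ⟨x, y₀⟩ hx
      have := (mem_iff_mem_twistedSum hcard (hsnd hx) hu x).1 hx
      rw [show α * u + x = α * u' + (x + (α * u - α * u')) by ring,
        ← mem_iff_mem_twistedSum hcard (hsnd hx) hu'] at this
      simpa using this)
    exact sub_eq_zero.1 (Prod.ext_iff.1 h).1
  have htranslate : ∀ y' ∈ U.image Prod.snd, ∀ w, (w, β * y') ∈ U →
      ∀ x, (x, y') ∈ U ↔ (x - α * w, 0) ∈ U := by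
    intro y' hy' w hw x
    rw [mem_iff_mem_twistedSum hcard hy' h0, mem_iff_mem_twistedSum hcard hzero hw]
    simp
  have hpow : ∀ k : ℕ, ∀ y' ∈ U.image Prod.snd, ∃ t, ∀ x, (x, y') ∈ U ↔ (x - α ^ k * t, 0) ∈ U := by
    intro k
    induction k with
    | zero =>
      intro y' hy'
      obtain ⟨⟨w, _⟩, hw, rfl⟩ := Finset.mem_image.1 (hstable 0 hzero y' hy')
      simp only [zero_add] at hw
      exact ⟨α * w, by simpa using htranslate y' hy' w (by simpa using hw)⟩
    | succ k ih =>
      intro y' hy'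
      obtain ⟨t, ht⟩ := ih (β * y') (by simpa using hstable 0 hzero y' hy')
      have hw : (α ^ k * t, β * y') ∈ U := (ht _).2 (by simpa using h0)
      refine ⟨t, fun x => ?_⟩
      rw [htranslate y' hy' _ hw, pow_succ', mul_assoc]
  obtain ⟨k, hk⟩ := hα
  have hfiber : ∀ y' ∈ U.image Prod.snd, ∀ x, (x, y') ∈ U ↔ (x, 0) ∈ U := by
    intro y' hy'
    obtain ⟨t, ht⟩ := hpow k y' hy'
    simpa [hk] using ht
  refine ⟨fun x y => ⟨fun h => ?_, fun h => (hfiber y (hsnd h.2) x).2 h.1⟩, ?_⟩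
  · exact ⟨(hfiber y (hsnd h) x).1 h, (hfiber y (hsnd h) 0).2 h0⟩
  · rintro ⟨x, y⟩ h
    refine ⟨?_, ?_⟩
    · simpa using hconst x 0 0 ((hfiber y (hsnd h) x).1 h) h0
    · refine (Prod.ext_iff.1 (hnp (0, β * y) ?_)).2
      rintro ⟨x', y'⟩ h'
      have hmem := (hfiber _ (hstable y' (hsnd h') y (hsnd h)) x').2
        ((hfiber _ (hsnd h') x').1 h')
      simpa using hmem

end twistedSum

/-- Every positive integer splits into a part dividing a power of `a` and a part coprime to `a`. -/
lemma exists_eq_mul_dvd_pow_coprime (a g : ℕ) (hg : 0 < g) :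
    ∃ m n k : ℕ, g = m * n ∧ m ∣ a ^ k ∧ Nat.Coprime n a := by
  induction g using Nat.strong_induction_on with
  | _ g ih =>
    by_cases h : Nat.Coprime g a
    · exact ⟨1, g, 0, by simp, by simp, h⟩
    · obtain ⟨g', hg'⟩ := Nat.gcd_dvd_left g a
      have hpos : 0 < g' := Nat.pos_of_ne_zero (by rintro rfl; omega)
      have hd : 2 ≤ Nat.gcd g a := by
        have := Nat.gcd_pos_of_pos_left a hg
        have : Nat.gcd g a ≠ 1 := h
        omega
      obtain ⟨m, n, k, rfl, hm, hn⟩ := ih g' (by nlinarith) hpos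
      refine ⟨Nat.gcd g a * m, n, k + 1, by rw [mul_assoc]; exact hg', ?_, hn⟩
      rw [pow_succ']
      exact mul_dvd_mul (Nat.gcd_dvd_right g a) hm

/-- Under an isomorphism `ZMod g ≃+* ZMod m × ZMod n` separating the primes of `a` and of `b`,
an aperiodic generating set with small sum of dilates is the direct sum of its intersections with
the two factors. -/
lemma dvd_and_mem_iff_of_card_le {g m n a b k : ℕ} [NeZero g]
    (hma : m ∣ a ^ k) (hna : Nat.Coprime n a) (hmb : Nat.Coprime m b)
    (φ : ZMod g ≃+* ZMod m × ZMod n) (U : Finset (ZMod g)) (h0 : (0 : ZMod g) ∈ U)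
    (hnp : ∀ h : ZMod g, Finset.image (fun x => x + h) U = U → h = 0)
    (hgen : ∀ H : AddSubgroup (ZMod g), (↑U : Set (ZMod g)) ⊆ (H : Set (ZMod g)) → H = ⊤)
    (hcard : (Finset.image₂ (fun x y => (a : ZMod g) * x + (b : ZMod g) * y) U U).card ≤ U.card) :
    (m ∣ a ∧ n ∣ b) ∧ ∀ u, u ∈ U ↔ φ.symm ((φ u).1, 0) ∈ U ∧ φ.symm (0, (φ u).2) ∈ U := by
  obtain ⟨a', ha'⟩ := (ZMod.isUnit_iff_coprime a n).2 hna.symm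
  obtain ⟨b', hb'⟩ := (ZMod.isUnit_iff_coprime b m).2 hmb.symm
  set α : ZMod m := (↑b'⁻¹ : ZMod m) * a with hα
  set β : ZMod n := (↑a'⁻¹ : ZMod n) * b with hβ
  have hbu : (↑b'⁻¹ : ZMod m) * b = 1 := by rw [← hb', Units.inv_mul]
  have hau : (↑a'⁻¹ : ZMod n) * a = 1 := by rw [← ha', Units.inv_mul]
  have hmem : ∀ p, p ∈ U.image φ ↔ φ.symm p ∈ U := by
    intro p
    rw [Finset.mem_image]
    exact ⟨by rintro ⟨u, hu, rfl⟩; simpa using hu, fun h => ⟨_, h, by simp⟩⟩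
  have hcardφ : (U.image φ).card = U.card := Finset.card_image_of_injective _ φ.injective
  have hsum : twistedSum α β (U.image φ) =
      (Finset.image₂ (fun x y => (a : ZMod g) * x + (b : ZMod g) * y) U U).image
        (fun z => ((↑b'⁻¹ : ZMod m) * (φ z).1, (↑a'⁻¹ : ZMod n) * (φ z).2)) := by
    rw [twistedSum, Finset.image₂_image_left, Finset.image₂_image_right, Finset.image_image₂]
    refine Finset.image₂_congr fun x _ y _ => Prod.ext ?_ ?_
    · simp only [hα, map_add, map_mul, map_natCast, Prod.fst_add, Prod.fst_mul, Prod.fst_natCast]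
      linear_combination (-(φ y).1) * hbu
    · simp only [hβ, map_add, map_mul, map_natCast, Prod.snd_add, Prod.snd_mul, Prod.snd_natCast]
      linear_combination (-(φ x).2) * hau
  have hnil : IsNilpotent α := by
    refine ⟨k, ?_⟩
    rw [hα, mul_pow, ← Nat.cast_pow, (ZMod.natCast_eq_zero_iff _ _).2 hma, mul_zero]
  obtain ⟨hprod, hann⟩ := exists_eq_product_of_card_twistedSum_le (β := β) (U := U.image φ) hnil
    ((hmem _).2 (by simpa [← Prod.zero_eq_mk] using h0)) (by
      intro h hh
      have := hnp (φ.symm h) (Finset.eq_of_subset_of_card_le (by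
        intro x hx
        obtain ⟨u, hu, rfl⟩ := Finset.mem_image.1 hx
        have := (hmem _).1 (hh (φ u) (Finset.mem_image_of_mem _ hu))
        simpa using this)
        (Finset.card_image_of_injective _ (add_left_injective _)).ge)
      simpa using this)
    (by rw [hsum, hcardφ]; exact Finset.card_image_le.trans hcard)
  have hone : φ.symm 1 ∈ (((AddMonoidHom.mulLeft (α, β)).comp φ.toAddMonoidHom).ker) := by
    have htop := hgen ((AddMonoidHom.mulLeft (α, β)).comp φ.toAddMonoidHom).ker fun u hu =>
      have hu := hann (φ u) (Finset.mem_image_of_mem _ hu)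
      Prod.ext hu.1 hu.2
    exact htop ▸ AddSubgroup.mem_top _
  have hαβ : (α, β) = 0 := by
    have : (α, β) * φ (φ.symm 1) = 0 := hone
    simpa using this
  refine ⟨⟨(ZMod.natCast_eq_zero_iff _ _).1 ?_, (ZMod.natCast_eq_zero_iff _ _).1 ?_⟩, fun u => ?_⟩
  · exact (Units.mul_right_eq_zero b'⁻¹).1 (Prod.ext_iff.1 hαβ).1
  · exact (Units.mul_right_eq_zero a'⁻¹).1 (Prod.ext_iff.1 hαβ).2
  · have := hprod (φ u).1 (φ u).2
    rw [hmem, hmem, hmem] at this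
    simpa using this

lemma gcd_mul_gcd_and_exists_of_card_le (g : ℕ) [NeZero g] (a b : ℕ) (hab : Nat.Coprime a b)
    (U : Finset (ZMod g)) (h0 : (0 : ZMod g) ∈ U)
    (hnp : ∀ h : ZMod g, Finset.image (fun x => x + h) U = U → h = 0)
    (hgen : ∀ H : AddSubgroup (ZMod g), (↑U : Set (ZMod g)) ⊆ (H : Set (ZMod g)) → H = ⊤)
    (hcard : (Finset.image₂ (fun x y => (a : ZMod g) * x + (b : ZMod g) * y) U U).card ≤ U.card) :
    g = Nat.gcd g a * Nat.gcd g b ∧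
      ∃ V X : Finset (ZMod g),
        (∀ v ∈ V, ∃ w : ZMod g, v = ((Nat.gcd g b : ℕ) : ZMod g) * w) ∧
        (∀ x ∈ X, ∃ w : ZMod g, x = ((Nat.gcd g a : ℕ) : ZMod g) * w) ∧
        U = Finset.image₂ (fun v x => v + x) V X ∧
        U.card = V.card * X.card := by
  obtain ⟨m, n, k, hg, hma, hna⟩ := exists_eq_mul_dvd_pow_coprime a g (NeZero.pos g)
  have hmn : Nat.Coprime m n := (Nat.Coprime.pow_right k hna).symm.coprime_dvd_left hma
  have hmb : Nat.Coprime m b := (Nat.Coprime.pow_left k hab).coprime_dvd_left hma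
  let φ : ZMod g ≃+* ZMod m × ZMod n := (ZMod.ringEquivCongr hg).trans (ZMod.chineseRemainder hmn)
  obtain ⟨⟨hm, hn⟩, hU⟩ := dvd_and_mem_iff_of_card_le hma hna hmb φ U h0 hnp hgen hcard
  have hga : Nat.gcd g a = m := by
    rw [hg, Nat.Coprime.gcd_mul_right_cancel m hna, Nat.gcd_eq_left hm]
  have hgb : Nat.gcd g b = n := by
    rw [hg, Nat.Coprime.gcd_mul_left_cancel n hmb, Nat.gcd_eq_left hn]
  rw [hga, hgb]
  have himage : U = Finset.image₂ (fun v x => v + x)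
      (U.filter fun u => (φ u).2 = 0) (U.filter fun u => (φ u).1 = 0) := by
    ext u
    simp only [Finset.mem_image₂, Finset.mem_filter]
    constructor
    · intro hu
      refine ⟨_, ⟨((hU u).1 hu).1, by simp⟩, _, ⟨((hU u).1 hu).2, by simp⟩, ?_⟩
      rw [← map_add]
      simp
    · rintro ⟨v, ⟨hv, hv'⟩, x, ⟨hx, hx'⟩, rfl⟩
      refine (hU _).2 ⟨?_, ?_⟩
      · rw [map_add, Prod.fst_add, hx', add_zero, ← hv']
        simpa using hv
      · rw [map_add, Prod.snd_add, hv', zero_add, ← hx']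
        simpa using hx
  refine ⟨hg, U.filter fun u => (φ u).2 = 0, U.filter fun u => (φ u).1 = 0, ?_, ?_, himage, ?_⟩
  · intro v hv
    refine ⟨φ.symm ((n : ZMod m)⁻¹ * (φ v).1, 0), φ.injective (Prod.ext ?_ ?_)⟩
    · simp [← mul_assoc, ZMod.coe_mul_inv_eq_one n hmn.symm]
    · simp [(Finset.mem_filter.1 hv).2]
  · intro x hx
    refine ⟨φ.symm (0, (m : ZMod n)⁻¹ * (φ x).2), φ.injective (Prod.ext ?_ ?_)⟩
    · simp [(Finset.mem_filter.1 hx).2]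
    · simp [← mul_assoc, ZMod.coe_mul_inv_eq_one m hmn]
  · conv_lhs => rw [himage]
    refine Finset.card_image₂_iff.2 ?_
    rintro ⟨v, x⟩ hp ⟨v', x'⟩ hp' h
    have hp := Set.mem_prod.1 hp
    have hp' := Set.mem_prod.1 hp'
    simp only [Finset.coe_filter, Set.mem_ofPred_eq] at hp hp' h
    have h := congrArg φ h
    rw [map_add, map_add] at h
    have h1 := congrArg Prod.fst h
    have h2 := congrArg Prod.snd h
    simp only [Prod.fst_add, Prod.snd_add, hp.1.2, hp.2.2, hp'.1.2, hp'.2.2, add_zero,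
      zero_add] at h1 h2
    exact Prod.ext (φ.injective (Prod.ext h1 (hp.1.2.trans hp'.1.2.symm)))
      (φ.injective (Prod.ext (hp.2.2.trans hp'.2.2.symm) h2))

lemma eq_zero_of_coprime_mul {R : Type*} [CommRing R] {s t : ℕ} (h : Nat.Coprime s t) {x : R}
    (hs : (s : R) * x = 0) (ht : (t : R) * x = 0) : x = 0 := by
  obtain ⟨u, v, huv⟩ := (Nat.isCoprime_iff_coprime.2 h).map (Int.castRingHom R)
  simp only [eq_intCast, Int.cast_natCast] at huv
  linear_combination u * hs + v * ht - x * huv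

lemma card_image₂_eq_of_decomposition (g a b : ℕ) (hab : Nat.Coprime a b)
    (hg : g = Nat.gcd g a * Nat.gcd g b) (V X : Finset (ZMod g))
    (hV : ∀ v ∈ V, ∃ w : ZMod g, v = ((Nat.gcd g b : ℕ) : ZMod g) * w)
    (hX : ∀ x ∈ X, ∃ w : ZMod g, x = ((Nat.gcd g a : ℕ) : ZMod g) * w) :
    (Finset.image₂ (fun x y => (a : ZMod g) * x + (b : ZMod g) * y)
      (Finset.image₂ (fun v x => v + x) V X) (Finset.image₂ (fun v x => v + x) V X)).card =
      V.card * X.card := by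
  have hdvda := Nat.gcd_dvd_right g a
  have hdvdb := Nat.gcd_dvd_right g b
  set d := Nat.gcd g a
  set e := Nat.gcd g b
  have hde : (d : ZMod g) * e = 0 := by rw [← Nat.cast_mul, ← hg, ZMod.natCast_self]
  have hae : (a : ZMod g) * e = 0 := by
    obtain ⟨c, hc⟩ := hdvda
    rw [hc, Nat.cast_mul]
    linear_combination (c : ZMod g) * hde
  have hbd : (b : ZMod g) * d = 0 := by
    obtain ⟨c, hc⟩ := hdvdb
    rw [hc, Nat.cast_mul]
    linear_combination (c : ZMod g) * hde
  have hcop_ae : Nat.Coprime a e := hab.coprime_dvd_right hdvdb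
  have hcop_de : Nat.Coprime d e := hcop_ae.coprime_dvd_left hdvda
  have hcop_bd : Nat.Coprime b d := hab.symm.coprime_dvd_right hdvda
  have haV : ∀ v ∈ V, (a : ZMod g) * v = 0 := by
    intro v hv
    obtain ⟨w, rfl⟩ := hV v hv
    rw [← mul_assoc, hae, zero_mul]
  have hbX : ∀ x ∈ X, (b : ZMod g) * x = 0 := by
    intro x hx
    obtain ⟨w, rfl⟩ := hX x hx
    rw [← mul_assoc, hbd, zero_mul]
  have hdV : ∀ v ∈ V, (d : ZMod g) * v = 0 := by
    intro v hv
    obtain ⟨w, rfl⟩ := hV v hv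
    rw [← mul_assoc, hde, zero_mul]
  have heX : ∀ x ∈ X, (e : ZMod g) * x = 0 := by
    intro x hx
    obtain ⟨w, rfl⟩ := hX x hx
    linear_combination w * hde
  have hset : Finset.image₂ (fun x y => (a : ZMod g) * x + (b : ZMod g) * y)
      (Finset.image₂ (fun v x => v + x) V X) (Finset.image₂ (fun v x => v + x) V X) =
      Finset.image₂ (fun v x => (a : ZMod g) * x + (b : ZMod g) * v) V X := by
    ext z
    simp only [Finset.mem_image₂]
    constructor
    · rintro ⟨_, ⟨v, hv, x, hx, rfl⟩, _, ⟨v', hv', x', hx', rfl⟩, rfl⟩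
      exact ⟨v', hv', x, hx, by linear_combination -haV v hv - hbX x' hx'⟩
    · rintro ⟨v, hv, x, hx, rfl⟩
      exact ⟨_, ⟨v, hv, x, hx, rfl⟩, _, ⟨v, hv, x, hx, rfl⟩,
        by linear_combination haV v hv + hbX x hx⟩
  rw [hset]
  refine Finset.card_image₂_iff.2 ?_
  rintro ⟨v, x⟩ hp ⟨v', x'⟩ hp' h
  obtain ⟨hv, hx⟩ : v ∈ V ∧ x ∈ X := by simpa using hp
  obtain ⟨hv', hx'⟩ : v' ∈ V ∧ x' ∈ X := by simpa using hp'
  simp only at h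
  have hxx : x - x' = 0 := by
    refine eq_zero_of_coprime_mul (hcop_de.mul_left hcop_ae) ?_ ?_
    · rw [Nat.cast_mul]
      linear_combination (d : ZMod g) * h - (b : ZMod g) * hdV v hv + (b : ZMod g) * hdV v' hv'
    · linear_combination heX x hx - heX x' hx'
  have hvv : v - v' = 0 := by
    refine eq_zero_of_coprime_mul hcop_bd ?_ ?_
    · linear_combination h - (a : ZMod g) * hxx
    · linear_combination hdV v hv - hdV v' hv'
  exact Prod.ext (sub_eq_zero.1 hvv) (sub_eq_zero.1 hxx)


theorem card_eq_iff_decomposition (g : ℕ) [NeZero g]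
    (a b : ℕ) (ha : 0 < a) (hb : 0 < b) (hab : Nat.Coprime a b)
    (U : Finset (ZMod g)) (h0 : (0 : ZMod g) ∈ U)
    (hnp : ∀ h : ZMod g, Finset.image (fun x => x + h) U = U → h = 0)
    (hgen : ∀ H : AddSubgroup (ZMod g), (↑U : Set (ZMod g)) ⊆ (H : Set (ZMod g)) → H = ⊤) :
    (Finset.image₂ (fun x y => (a : ZMod g) * x + (b : ZMod g) * y) U U).card = U.card ↔
      (g = Nat.gcd g a * Nat.gcd g b ∧
        ∃ V X : Finset (ZMod g),
          (∀ v ∈ V, ∃ w : ZMod g, v = ((Nat.gcd g b : ℕ) : ZMod g) * w) ∧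
          (∀ x ∈ X, ∃ w : ZMod g, x = ((Nat.gcd g a : ℕ) : ZMod g) * w) ∧
          U = Finset.image₂ (fun v x => v + x) V X ∧
          U.card = V.card * X.card) := by
  constructor
  · intro h
    exact gcd_mul_gcd_and_exists_of_card_le g a b hab U h0 hnp hgen h.le
  · rintro ⟨hg, V, X, hV, hX, hU, hcard⟩
    rw [hcard, hU]
    exact card_image₂_eq_of_decomposition g a b hab hg V X hV hX
end
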